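/- Let S and A be finite nonempty sets, p a transition kernel assigning to each (s,a) a probability vector p(·|s,a) on S, r : S × A → ℝ, and let π and π̃ be stochastic policies (for each s, π(·|s) and π̃(·|s) are probability vectors on A). Suppose: (i) μ̃ is a probability vector on S stationary under π̃, i.e. Σ_{s,a} μ̃(s) π̃(a|s) p(s'|s,a) = μ̃(s') for all s'; (ii) J̃ := Σ_{s,a} μ̃(s) π̃(a|s) r(s,a); (iii) J ∈ ℝ, v : S → ℝ and q : S × A → ℝ satisfy the Bellman equation q(s,a) = r(s,a) − J + Σ_{s'} p(s'|s,a) v(s') for all (s,a), together with v(s) = Σ_a π(a|s) q(s,a) for all s. Then J̃ − J = Σ_s Σ_a μ̃(s) (π̃(a|s) − π(a|s)) q(s,a). -/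

import Mathlib

open Finset

/-- The performance-difference lemma (Lemma 2 of Neu et al., 2013):
`J̃ - J = Σ_s Σ_a μ̃(s) (π̃(a|s) - π(a|s)) q(s,a)`. -/
theorem performance_difference
    {S A : Type*} [Fintype S] [Fintype A] [Nonempty S] [Nonempty A]
    (p : S → A → S → ℝ)
    (hp0 : ∀ s a s', 0 ≤ p s a s') (hp1 : ∀ s a, ∑ s', p s a s' = 1)
    (r : S → A → ℝ)
    (π πt : S → A → ℝ)
    (hπ0 : ∀ s a, 0 ≤ π s a) (hπ1 : ∀ s, ∑ a, π s a = 1)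
    (hπt0 : ∀ s a, 0 ≤ πt s a) (hπt1 : ∀ s, ∑ a, πt s a = 1)
    (μt : S → ℝ) (hμt0 : ∀ s, 0 ≤ μt s) (hμt1 : ∑ s, μt s = 1)
    (hstat : ∀ s', ∑ s, ∑ a, μt s * πt s a * p s a s' = μt s')
    (Jt : ℝ) (hJt : Jt = ∑ s, ∑ a, μt s * πt s a * r s a)
    (J : ℝ) (v : S → ℝ) (q : S → A → ℝ)
    (hq : ∀ s a, q s a = r s a - J + ∑ s', p s a s' * v s')
    (hv : ∀ s, v s = ∑ a, π s a * q s a) :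
    Jt - J = ∑ s, ∑ a, μt s * (πt s a - π s a) * q s a := by
  have h1 : ∑ s, ∑ a, μt s * π s a * q s a = ∑ s, μt s * v s := by
    refine Finset.sum_congr rfl fun s _ => ?_
    rw [hv s, Finset.mul_sum]
    exact Finset.sum_congr rfl fun a _ => by ring
  have h2 : ∑ s, ∑ a, μt s * πt s a * J = J := by
    have h : ∀ s, ∑ a, μt s * πt s a * J = μt s * J := fun s => by
      rw [← Finset.sum_mul, ← Finset.mul_sum, hπt1 s, mul_one]
    simp only [h]
    rw [← Finset.sum_mul, hμt1, one_mul]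
  have h3 : ∑ s, ∑ a, μt s * πt s a * ∑ s', p s a s' * v s' = ∑ s', μt s' * v s' := by
    have h : ∀ s', μt s' * v s' = ∑ s, ∑ a, μt s * πt s a * (p s a s' * v s') := fun s' => by
      conv_lhs => rw [← hstat s']
      rw [Finset.sum_mul]
      refine Finset.sum_congr rfl fun s _ => ?_
      rw [Finset.sum_mul]
      exact Finset.sum_congr rfl fun a _ => by ring
    rw [Finset.sum_congr rfl fun s' _ => h s']
    refine Eq.trans ?_ Finset.sum_comm
    refine Finset.sum_congr rfl fun s _ => ?_
    refine Eq.trans ?_ Finset.sum_comm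
    exact Finset.sum_congr rfl fun a _ => by rw [Finset.mul_sum]
  have h4 : ∑ s, ∑ a, μt s * πt s a * q s a = Jt - J + ∑ s, μt s * v s := by
    rw [← h3, hJt]
    conv_rhs => rw [← h2]
    simp only [← Finset.sum_sub_distrib, ← Finset.sum_add_distrib]
    refine Finset.sum_congr rfl fun s _ => Finset.sum_congr rfl fun a _ => ?_
    rw [hq s a]; ring
  have h5 : ∑ s, ∑ a, μt s * (πt s a - π s a) * q s a
      = ∑ s, ∑ a, μt s * πt s a * q s a - ∑ s, ∑ a, μt s * π s a * q s a := by
    simp only [← Finset.sum_sub_distrib]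
    exact Finset.sum_congr rfl fun s _ => Finset.sum_congr rfl fun a _ => by ring
  rw [h5, h4, h1]; ring
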